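/- With the combinatorial model of the Kirillov–Reshetikhin crystal B_s = B^{1,s} of type D_{n+1}^{(2)}, the operators f̃_i, and the maps Ψ_j as in the context: (i) for every j ∈ {1,…,n−1} and 0 ≤ k ≤ l−2, Ψ_j maps B(kθ) ⊂ B_{l−2} into B((k+2)θ) ⊂ B_l; (ii) for every 0 ≤ k ≤ l−1, Ψ_n maps B(kθ) ⊂ B_{l−1} into B((k+1)θ) ⊂ B_l; (iii) for every j ∈ {1,…,n}, every i ∈ {1,…,n}, and every b in the domain of Ψ_j (B_{l−2} if j < n, B_{l−1} if j = n) with f̃_i b ≠ 0, one has Ψ_j(f̃_i b) = f̃_i(Ψ_j b); (iv) for every j ∈ {1,…,n}, Ψ_j(f̃_0 b) = f̃_0(Ψ_j b) for all b in the domain of Ψ_j (with the convention Ψ_j(0) = 0). -/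

import Mathlib

/-- Model of the KR crystal `B^{1,s}` of type `D_{n+1}^{(2)}`: a tuple
`(x₁, …, x_n, x₀, x̄_n, …, x̄₁)`, encoded as `b = (x, x₀, x̄)` with `x = b.1`,
`x₀ = b.2.1` and `x̄ = b.2.2`. -/
abbrev DCrystal (n : ℕ) := (Fin n → ℕ) × ℕ × (Fin n → ℕ)

/-- `∑_{j=1}^{n} (x_j + x̄_j) + x₀`. -/
def dsum (n : ℕ) (b : DCrystal n) : ℕ := (∑ j, (b.1 j + b.2.2 j)) + b.2.1

/-- Membership in `B_s = B^{1,s}`: `x₀ ∈ {0, 1}` and the coordinate sum is at most `s`. -/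
def inBD (n s : ℕ) (b : DCrystal n) : Prop := b.2.1 ≤ 1 ∧ dsum n b ≤ s

/-- The weight `wt b = (x₁ − x̄₁, …, x_n − x̄_n)`. -/
def wtDof (n : ℕ) (b : DCrystal n) : Fin n → ℤ := fun j => (b.1 j : ℤ) - (b.2.2 j : ℤ)

/-- `f̃_0` on `B_s`: `x₁ ↦ x₁ + 1` if `x₁ ≥ x̄₁`, and `x̄₁ ↦ x̄₁ − 1` if `x₁ < x̄₁`;
the result is `0` (`none`) if the resulting tuple does not lie in `B_s`. -/
def fD0 (n : ℕ) (hn : 0 < n) (s : ℕ) (b : DCrystal n) : Option (DCrystal n) :=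
  let i0 : Fin n := ⟨0, hn⟩
  if b.2.2 i0 ≤ b.1 i0 then
    if dsum n b + 1 ≤ s then
      some (Function.update b.1 i0 (b.1 i0 + 1), b.2.1, b.2.2)
    else none
  else
    some (b.1, b.2.1, Function.update b.2.2 i0 (b.2.2 i0 - 1))

/-- `f̃_i` for `1 ≤ i ≤ n−1` (here `i = i₀ + 1`): `(x_i, x_{i+1}) ↦ (x_i − 1, x_{i+1} + 1)`
if `x_{i+1} ≥ x̄_{i+1}`, and `(x̄_{i+1}, x̄_i) ↦ (x̄_{i+1} − 1, x̄_i + 1)` otherwise;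
the result is `0` (`none`) if a coordinate would become negative. -/
def fDi (n i₀ : ℕ) (h : i₀ + 1 < n) (b : DCrystal n) : Option (DCrystal n) :=
  let a : Fin n := ⟨i₀, by omega⟩
  let a' : Fin n := ⟨i₀ + 1, h⟩
  if b.2.2 a' ≤ b.1 a' then
    if 0 < b.1 a then
      some (Function.update (Function.update b.1 a (b.1 a - 1)) a' (b.1 a' + 1), b.2)
    else none
  else
    if 0 < b.2.2 a' then
      some (b.1, b.2.1,
        Function.update (Function.update b.2.2 a' (b.2.2 a' - 1)) a (b.2.2 a + 1))
    else none

/-- `f̃_n`: `(x_n, x₀) ↦ (x_n − 1, x₀ + 1)` if `x₀ = 0` (the result being `0` if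
`x_n = 0`), and `(x₀, x̄_n) ↦ (x₀ − 1, x̄_n + 1)` if `x₀ = 1`. -/
def fDn (n : ℕ) (hn : 0 < n) (b : DCrystal n) : Option (DCrystal n) :=
  let a : Fin n := ⟨n - 1, by omega⟩
  if b.2.1 = 0 then
    if 0 < b.1 a then
      some (Function.update b.1 a (b.1 a - 1), 1, b.2.2)
    else none
  else
    some (b.1, b.2.1 - 1, Function.update b.2.2 a (b.2.2 a + 1))

/-- `Ψ_j : B_{l−2} → B_l` for `1 ≤ j ≤ n−1` adds `1` to both `x_j` and `x̄_j`
(here the index `j` is `a + 1` for `a : Fin n`). -/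
def PsiJ (n : ℕ) (a : Fin n) (b : DCrystal n) : DCrystal n :=
  (Function.update b.1 a (b.1 a + 1), b.2.1, Function.update b.2.2 a (b.2.2 a + 1))

/-- `Ψ_n : B_{l−1} → B_l`: replaces `x₀` by `x₀ + 1` if `x₀ = 0`, and replaces
`(x_n, x₀, x̄_n)` by `(x_n + 1, x₀ − 1, x̄_n + 1)` if `x₀ = 1`. -/
def PsiN (n : ℕ) (hn : 0 < n) (b : DCrystal n) : DCrystal n :=
  let a : Fin n := ⟨n - 1, by omega⟩
  if b.2.1 = 0 then (b.1, b.2.1 + 1, b.2.2)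
  else (Function.update b.1 a (b.1 a + 1), b.2.1 - 1, Function.update b.2.2 a (b.2.2 a + 1))

theorem dsum_PsiJ (n : ℕ) (a : Fin n) (b : DCrystal n) :
    dsum n (PsiJ n a b) = dsum n b + 2 := by
  have h1 := Finset.sum_update_of_mem (Finset.mem_univ a) b.1 (b.1 a + 1)
  have h2 := Finset.sum_update_of_mem (Finset.mem_univ a) b.2.2 (b.2.2 a + 1)
  have h3 := Finset.sum_update_of_mem (Finset.mem_univ a) b.1 (b.1 a)
  have h4 := Finset.sum_update_of_mem (Finset.mem_univ a) b.2.2 (b.2.2 a)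
  rw [Function.update_eq_self] at h3 h4
  simp only [dsum, PsiJ, Finset.sum_add_distrib]
  omega

theorem dsum_PsiN (n : ℕ) (hn : 0 < n) (b : DCrystal n) (hb : b.2.1 ≤ 1) :
    dsum n (PsiN n hn b) = dsum n b + 1 := by
  have h := dsum_PsiJ n ⟨n - 1, by omega⟩ b
  simp only [dsum, PsiJ, PsiN] at h ⊢
  split_ifs <;> simp only <;> omega

set_option linter.all false in
set_option maxHeartbeats 4000000 in
theorem statement_16 (n l : ℕ) (hn : 2 ≤ n) (hl : 2 ≤ l) :
    -- (i) for `j ∈ {1, …, n−1}`, `Ψ_j` maps `B(kθ) ⊂ B_{l−2}` into `B((k+2)θ) ⊂ B_l`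
    (∀ a : Fin n, (a : ℕ) + 1 < n → ∀ k : ℕ, k ≤ l - 2 → ∀ b : DCrystal n,
      b.2.1 ≤ 1 → dsum n b = k →
      (PsiJ n a b).2.1 ≤ 1 ∧ dsum n (PsiJ n a b) = k + 2) ∧
    -- (ii) `Ψ_n` maps `B(kθ) ⊂ B_{l−1}` into `B((k+1)θ) ⊂ B_l`
    (∀ k : ℕ, k ≤ l - 1 → ∀ b : DCrystal n,
      b.2.1 ≤ 1 → dsum n b = k →
      (PsiN n (by omega) b).2.1 ≤ 1 ∧ dsum n (PsiN n (by omega) b) = k + 1) ∧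
    -- (iii) commutation with `f̃_i`, `i ∈ {1, …, n}`, on the respective domains,
    --       whenever `f̃_i b ≠ 0`
    (∀ a : Fin n, (a : ℕ) + 1 < n →
      (∀ i₀ : ℕ, ∀ h : i₀ + 1 < n, ∀ b : DCrystal n, inBD n (l - 2) b →
        fDi n i₀ h b ≠ none →
        Option.map (PsiJ n a) (fDi n i₀ h b) = fDi n i₀ h (PsiJ n a b)) ∧
      (∀ b : DCrystal n, inBD n (l - 2) b → fDn n (by omega) b ≠ none →
        Option.map (PsiJ n a) (fDn n (by omega) b) = fDn n (by omega) (PsiJ n a b))) ∧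
    ((∀ i₀ : ℕ, ∀ h : i₀ + 1 < n, ∀ b : DCrystal n, inBD n (l - 1) b →
        fDi n i₀ h b ≠ none →
        Option.map (PsiN n (by omega)) (fDi n i₀ h b) = fDi n i₀ h (PsiN n (by omega) b)) ∧
      (∀ b : DCrystal n, inBD n (l - 1) b → fDn n (by omega) b ≠ none →
        Option.map (PsiN n (by omega)) (fDn n (by omega) b)
          = fDn n (by omega) (PsiN n (by omega) b))) ∧
    -- (iv) commutation with `f̃_0` (with `Ψ_j(0) = 0`)
    (∀ a : Fin n, (a : ℕ) + 1 < n → ∀ b : DCrystal n, inBD n (l - 2) b →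
      Option.map (PsiJ n a) (fD0 n (by omega) (l - 2) b)
        = fD0 n (by omega) l (PsiJ n a b)) ∧
    (∀ b : DCrystal n, inBD n (l - 1) b →
      Option.map (PsiN n (by omega)) (fD0 n (by omega) (l - 1) b)
        = fD0 n (by omega) l (PsiN n (by omega) b)) := by
  refine ⟨?_, ?_, ?_, ⟨?_, ?_⟩, ?_, ?_⟩
  · intro a ha k hk b hb h
    exact ⟨hb, by rw [dsum_PsiJ, h]⟩
  · intro k hk b hb h
    refine ⟨?_, by rw [dsum_PsiN _ _ _ hb, h]⟩
    simp only [PsiN]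
    split_ifs <;> simp only <;> omega
  · intro a ha
    refine ⟨?_, ?_⟩
    · rintro i h ⟨x, z, y⟩ ⟨hb, hs⟩ hne
      simp only [fDi, PsiJ, Function.update_apply] at hne ⊢
      split_ifs at hne ⊢ <;> simp_all [PsiJ, PsiN, funext_iff, Function.update_apply] <;> grind
    · rintro ⟨x, z, y⟩ ⟨hb, hs⟩ hne
      simp only [fDn, PsiJ, Function.update_apply] at hne ⊢
      split_ifs at hne ⊢ <;> simp_all [PsiJ, PsiN, funext_iff, Function.update_apply] <;> grind
  · rintro i h ⟨x, z, y⟩ ⟨hb, hs⟩ hne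
    have hz : z = 0 ∨ z = 1 := by simp only at hb; omega
    rcases hz with rfl | rfl <;>
    simp only [fDi, PsiN, Function.update_apply] at hne ⊢ <;>
    split_ifs at hne ⊢ <;> simp_all [PsiJ, PsiN, funext_iff, Function.update_apply] <;> grind
  · rintro ⟨x, z, y⟩ ⟨hb, hs⟩ hne
    have hz : z = 0 ∨ z = 1 := by simp only at hb; omega
    clear hb hs
    rcases hz with rfl | rfl
    · by_cases hx : 0 < x ⟨n - 1, by omega⟩
      · simp only [fDn, PsiN, if_true, if_pos hx, Option.map_some]
        norm_num
        have e : x ⟨n - 1, by omega⟩ - 1 + 1 = x ⟨n - 1, by omega⟩ := by omega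
        exact e
      · exact absurd (by simp only [fDn, if_true, if_neg hx]) hne
    · simp [fDn, PsiN]
  · rintro a ha b ⟨hb, hs⟩
    have hd := dsum_PsiJ n a b
    simp only [fD0, hd]
    clear hd
    obtain ⟨x, z, y⟩ := b
    simp only [PsiJ, Function.update_apply]
    split_ifs <;> simp_all [PsiJ, PsiN, funext_iff, Function.update_apply] <;> grind
  · rintro b ⟨hb, hs⟩
    have hd := dsum_PsiN n (by omega) b hb
    simp only [fD0, hd]
    obtain ⟨x, z, y⟩ := b
    have hz : z = 0 ∨ z = 1 := by simp only at hb; omega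
    clear hd
    rcases hz with rfl | rfl <;>
    simp only [PsiN, Function.update_apply] <;>
    split_ifs <;> simp_all [PsiJ, PsiN, funext_iff, Function.update_apply] <;> grind
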